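/- Suppose in addition that for each agent j there is a map R_j : X̂_j(y_j,z_j) → S_j that is stage-wise causal (for any ζ, ζ' ∈ X̂_j(y_j,z_j) agreeing up to time t, R_j(ζ) and R_j(ζ') agree up to time t) and satisfies L_j(R_j(ζ)) = ζ for every ζ ∈ X̂_j(y_j,z_j). If (Γ_i, y_i, z_i)_{i=1}^M is a feasible solution of Problem LS, then the composed policies Ψ_{i,t}(ξ_i^{t−1}, ζ_{N_i}^t) := Γ_{i,t}(ξ_i^{t−1}, ((R_j(ζ_j))_{j∈N_i})^t) form a feasible solution (Ψ_i, y_i, z_i)_{i=1}^M of Problem LX̂ whose per-agent worst-case cost is at most that of (Γ_i, y_i, z_i) in Problem LS; hence the optimal value of Problem LX̂ is at most that of Problem LS, and combined with the reverse construction (composing feasible LX̂ policies with the maps L_j), the optimal values of Problem LX̂ and Problem LS are equal. -/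

import Mathlib

open Matrix

/-- Data of a networked linear system with `M` agents and horizon `T`: state, input and
disturbance dimensions `n, m, d`, neighbor sets `nbr`, known initial states `xInit`, dynamics
matrices `A, B, D, E` (with `B i t j` the block of `B_{i,t}` acting on the states of neighbor
`j`), disturbance sets `unc i = Ξᵢ`, operational constraint sets `cns i = 𝒪ᵢ` and objective
functions `obj i = Jᵢ`.  Time is `0`-based: stage `k : Fin T` corresponds to time `t = k+1`
of the paper, so that the state trajectory is indexed by `Fin (T+1)`. -/
structure NetSys (M T : ℕ) where
  n : Fin M → ℕ
  m : Fin M → ℕ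
  d : Fin M → ℕ
  nbr : Fin M → Finset (Fin M)
  xInit : ∀ i, Fin (n i) → ℝ
  A : ∀ i, Fin T → Matrix (Fin (n i)) (Fin (n i)) ℝ
  B : ∀ i, Fin T → ∀ j, Matrix (Fin (n i)) (Fin (n j)) ℝ
  D : ∀ i, Fin T → Matrix (Fin (n i)) (Fin (m i)) ℝ
  E : ∀ i, Fin T → Matrix (Fin (n i)) (Fin (d i)) ℝ
  unc : ∀ i, Set (Fin T → Fin (d i) → ℝ)
  cns : ∀ i, Set ((Fin (T+1) → Fin (n i) → ℝ) × (Fin T → Fin (m i) → ℝ))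
  obj : ∀ i, (Fin (T+1) → Fin (n i) → ℝ) → (Fin T → Fin (m i) → ℝ) → ℝ

namespace NetSys

variable {M T : ℕ} (S : NetSys M T)

/-- A disturbance profile for all agents. -/
def Prof : Type := ∀ i, Fin T → Fin (S.d i) → ℝ

/-- Membership of a disturbance profile in `Ξ = Ξ₁ × ⋯ × Ξ_M`. -/
def memUnc (ξ : S.Prof) : Prop := ∀ i, ξ i ∈ S.unc i

/-- The interconnected network closed-loop equations for a given input profile `u`:
`x` is the closed-loop state trajectory profile. -/
def NetTraj (ξ : S.Prof) (u : ∀ i, Fin T → Fin (S.m i) → ℝ)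
    (x : ∀ i, Fin (T+1) → Fin (S.n i) → ℝ) : Prop :=
  ∀ i, x i 0 = S.xInit i ∧
    ∀ k : Fin T,
      x i k.succ =
        S.A i k *ᵥ x i k.castSucc +
        (∑ j ∈ (S.nbr i).attach, S.B i k j.1 *ᵥ x j.1 k.castSucc) +
        S.D i k *ᵥ u i k + S.E i k *ᵥ ξ i k


/-- Belief trajectories of the neighbors of agent `i`: for each neighbor `j ∈ Nᵢ`, a state
trajectory `ζⱼ` of agent `j`. -/
def Beliefs (i : Fin M) : Type :=
  (j : {j // j ∈ S.nbr i}) → Fin (T+1) → Fin (S.n j.1) → ℝ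

/-- Local information policies (Problem L): the input of agent `i` at stage `k` is a function
of its own disturbance trajectory and of the belief trajectories of its neighbors. -/
def LPol : Type :=
  ∀ i, Fin T → (Fin T → Fin (S.d i) → ℝ) → S.Beliefs i → Fin (S.m i) → ℝ

/-- Causality of a local information policy: strictly causal in the agent's own disturbances
(stages `< k`) and causal in the neighbors' beliefs (times `≤ k`). -/
def LCausal (Ψ : S.LPol) : Prop :=
  ∀ i (k : Fin T) (ξ ξ' : Fin T → Fin (S.d i) → ℝ) (ζ ζ' : S.Beliefs i),
    (∀ s : Fin T, (s : ℕ) < (k : ℕ) → ξ s = ξ' s) →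
    (∀ (j : {j // j ∈ S.nbr i}) (s : Fin (T+1)), (s : ℕ) ≤ (k : ℕ) → ζ j s = ζ' j s) →
    Ψ i k ξ ζ = Ψ i k ξ' ζ'

/-- The local closed-loop equations of agent `i`, with the belief trajectories `ζ`
substituted for the actual neighbor states. -/
def LocalTraj (i : Fin M) (ξi : Fin T → Fin (S.d i) → ℝ) (ζ : S.Beliefs i)
    (u : Fin T → Fin (S.m i) → ℝ) (x : Fin (T+1) → Fin (S.n i) → ℝ) : Prop :=
  x 0 = S.xInit i ∧
    ∀ k : Fin T,
      x k.succ =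
        S.A i k *ᵥ x k.castSucc +
        (∑ j ∈ (S.nbr i).attach, S.B i k j.1 *ᵥ ζ j k.castSucc) +
        S.D i k *ᵥ u k + S.E i k *ᵥ ξi k


end NetSys

/-- Per-agent conic set data on the trajectory space `ℝ^{N_i^x}` (identified with
`Fin (T+1) → Fin (nᵢ) → ℝ`): for each agent `i`, `KN i` constraints consisting of convex
cones `Kc`, linear maps `Gm`, vectors `gv` and stage-wise projections `Pm`. -/
structure ConicData {M T : ℕ} (S : NetSys M T) where
  KN : Fin M → ℕ
  lk : ∀ i, Fin (KN i) → ℕ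
  Kc : ∀ i k, ConvexCone ℝ (Fin (lk i k) → ℝ)
  Gm : ∀ i k, (Fin (T+1) → Fin (S.n i) → ℝ) →ₗ[ℝ] (Fin (lk i k) → ℝ)
  gv : ∀ i k, Fin (lk i k) → ℝ
  Pm : ∀ (i : Fin M), Fin (KN i) →
    ((Fin (T+1) → Fin (S.n i) → ℝ) →ₗ[ℝ] (Fin (T+1) → Fin (S.n i) → ℝ))

namespace ConicData

variable {M T : ℕ} {S : NetSys M T} (C : ConicData S)

/-- The primitive set `Sᵢ = {s : g_{i,k} − G_{i,k}P_{i,k}s ∈ K_{i,k}}` of agent `i`. -/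
def prim (i : Fin M) : Set (Fin (T+1) → Fin (S.n i) → ℝ) :=
  {s | ∀ k, C.gv i k - C.Gm i k (C.Pm i k s) ∈ C.Kc i k}

/-- The scaled-translated map `L_i(s) = Σₖ y_{i,k} P_{i,k} s + z_i`. -/
def Lmap (i : Fin M) (yi : Fin (C.KN i) → ℝ) (zi : Fin (T+1) → Fin (S.n i) → ℝ)
    (s : Fin (T+1) → Fin (S.n i) → ℝ) : Fin (T+1) → Fin (S.n i) → ℝ :=
  (∑ k, yi k • C.Pm i k s) + zi

/-- The communicated state forecast set `X̂ᵢ(yᵢ,zᵢ)` of agent `i`. -/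
def hatX (i : Fin M) (yi : Fin (C.KN i) → ℝ) (zi : Fin (T+1) → Fin (S.n i) → ℝ) :
    Set (Fin (T+1) → Fin (S.n i) → ℝ) :=
  {x | ∃ ν : Fin (C.KN i) → (Fin (T+1) → Fin (S.n i) → ℝ),
    x = (∑ k, C.Pm i k (ν k)) + zi ∧
    ∀ k, yi k • C.gv i k - C.Gm i k (C.Pm i k (ν k)) ∈ C.Kc i k}

/-- The beliefs `ζⱼ = Lⱼ(sⱼ)` induced by primitive-set elements `sⱼ`. -/
def lsBel (y : ∀ i, Fin (C.KN i) → ℝ) (z : ∀ i, Fin (T+1) → Fin (S.n i) → ℝ)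
    (i : Fin M) (s : S.Beliefs i) : S.Beliefs i :=
  fun j => C.Lmap j.1 (y j.1) (z j.1) (s j)

/-- Causality of a policy of Problem LX̂: strictly causal in the agent's own disturbances and
causal in the neighbors' belief trajectories ranging over the forecast sets `X̂ⱼ(yⱼ,zⱼ)`. -/
def LXCausal (Ψ : S.LPol) (y : ∀ i, Fin (C.KN i) → ℝ)
    (z : ∀ i, Fin (T+1) → Fin (S.n i) → ℝ) : Prop :=
  ∀ i (k : Fin T) (ξ ξ' : Fin T → Fin (S.d i) → ℝ) (ζ ζ' : S.Beliefs i),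
    (∀ j, ζ j ∈ C.hatX j.1 (y j.1) (z j.1)) →
    (∀ j, ζ' j ∈ C.hatX j.1 (y j.1) (z j.1)) →
    (∀ s : Fin T, (s : ℕ) < (k : ℕ) → ξ s = ξ' s) →
    (∀ j (s : Fin (T+1)), (s : ℕ) ≤ (k : ℕ) → ζ j s = ζ' j s) →
    Ψ i k ξ ζ = Ψ i k ξ' ζ'

/-- Feasibility in Problem LX̂. -/
def FeasLX (Ψ : S.LPol) (y : ∀ i, Fin (C.KN i) → ℝ)
    (z : ∀ i, Fin (T+1) → Fin (S.n i) → ℝ) : Prop :=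
  C.LXCausal Ψ y z ∧ (∀ i k, 0 ≤ y i k) ∧
    ∀ i (ξi : Fin T → Fin (S.d i) → ℝ), ξi ∈ S.unc i →
      ∀ ζ : S.Beliefs i, (∀ j, ζ j ∈ C.hatX j.1 (y j.1) (z j.1)) →
      ∀ x, S.LocalTraj i ξi ζ (fun k => Ψ i k ξi ζ) x →
        (x, fun k => Ψ i k ξi ζ) ∈ S.cns i ∧ x ∈ C.hatX i (y i) (z i)

/-- Worst-case cost of agent `i` in Problem LX̂. -/
noncomputable def CostLX (Ψ : S.LPol) (y : ∀ i, Fin (C.KN i) → ℝ)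
    (z : ∀ i, Fin (T+1) → Fin (S.n i) → ℝ) (i : Fin M) : EReal :=
  sSup {v : EReal | ∃ ξi, ξi ∈ S.unc i ∧
    ∃ ζ : S.Beliefs i, (∀ j, ζ j ∈ C.hatX j.1 (y j.1) (z j.1)) ∧
    ∃ x, S.LocalTraj i ξi ζ (fun k => Ψ i k ξi ζ) x ∧
      v = ((S.obj i x (fun k => Ψ i k ξi ζ) : ℝ) : EReal)}

/-- Optimal value of Problem LX̂. -/
noncomputable def OptLX : EReal :=
  sInf {v : EReal | ∃ (Ψ : S.LPol) (y : ∀ i, Fin (C.KN i) → ℝ)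
    (z : ∀ i, Fin (T+1) → Fin (S.n i) → ℝ),
    C.FeasLX Ψ y z ∧ v = ∑ i, C.CostLX Ψ y z i}

/-- Causality of a policy of Problem LS: strictly causal in the agent's own disturbances and
causal in the primitive-set trajectories `sⱼ` ranging over the sets `Sⱼ`. -/
def LSCausal (Γ : S.LPol) (y : ∀ i, Fin (C.KN i) → ℝ)
    (z : ∀ i, Fin (T+1) → Fin (S.n i) → ℝ) : Prop :=
  ∀ i (k : Fin T) (ξ ξ' : Fin T → Fin (S.d i) → ℝ) (s s' : S.Beliefs i),
    (∀ j, s j ∈ C.prim j.1) →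
    (∀ j, s' j ∈ C.prim j.1) →
    (∀ t : Fin T, (t : ℕ) < (k : ℕ) → ξ t = ξ' t) →
    (∀ j (t : Fin (T+1)), (t : ℕ) ≤ (k : ℕ) → s j t = s' j t) →
    Γ i k ξ s = Γ i k ξ' s'

/-- Feasibility in Problem LS. -/
def FeasLS (Γ : S.LPol) (y : ∀ i, Fin (C.KN i) → ℝ)
    (z : ∀ i, Fin (T+1) → Fin (S.n i) → ℝ) : Prop :=
  C.LSCausal Γ y z ∧ (∀ i k, 0 ≤ y i k) ∧
    ∀ i (ξi : Fin T → Fin (S.d i) → ℝ), ξi ∈ S.unc i →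
      ∀ s : S.Beliefs i, (∀ j, s j ∈ C.prim j.1) →
      ∀ x, S.LocalTraj i ξi (C.lsBel y z i s) (fun k => Γ i k ξi s) x →
        (x, fun k => Γ i k ξi s) ∈ S.cns i ∧ x ∈ C.hatX i (y i) (z i)

/-- Worst-case cost of agent `i` in Problem LS. -/
noncomputable def CostLS (Γ : S.LPol) (y : ∀ i, Fin (C.KN i) → ℝ)
    (z : ∀ i, Fin (T+1) → Fin (S.n i) → ℝ) (i : Fin M) : EReal :=
  sSup {v : EReal | ∃ ξi, ξi ∈ S.unc i ∧
    ∃ s : S.Beliefs i, (∀ j, s j ∈ C.prim j.1) ∧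
    ∃ x, S.LocalTraj i ξi (C.lsBel y z i s) (fun k => Γ i k ξi s) x ∧
      v = ((S.obj i x (fun k => Γ i k ξi s) : ℝ) : EReal)}

/-- Optimal value of Problem LS. -/
noncomputable def OptLS : EReal :=
  sInf {v : EReal | ∃ (Γ : S.LPol) (y : ∀ i, Fin (C.KN i) → ℝ)
    (z : ∀ i, Fin (T+1) → Fin (S.n i) → ℝ),
    C.FeasLS Γ y z ∧ v = ∑ i, C.CostLS Γ y z i}

end ConicData

namespace ConicData

variable {M T : ℕ} {S : NetSys M T} (C : ConicData S)

/-- A family of stage-wise causal right inverses of the maps `Lⱼ`, sending `X̂ⱼ(yⱼ,zⱼ)` into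
`Sⱼ`. -/
structure IsCausalSection (y : ∀ i, Fin (C.KN i) → ℝ)
    (z : ∀ i, Fin (T+1) → Fin (S.n i) → ℝ)
    (R : ∀ j : Fin M, (Fin (T+1) → Fin (S.n j) → ℝ) → (Fin (T+1) → Fin (S.n j) → ℝ)) :
    Prop where
  mem : ∀ j ζ, ζ ∈ C.hatX j (y j) (z j) → R j ζ ∈ C.prim j
  causal : ∀ j ζ ζ', ζ ∈ C.hatX j (y j) (z j) → ζ' ∈ C.hatX j (y j) (z j) →
    ∀ t : Fin (T+1), (∀ s : Fin (T+1), (s : ℕ) ≤ (t : ℕ) → ζ s = ζ' s) →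
      ∀ s : Fin (T+1), (s : ℕ) ≤ (t : ℕ) → R j ζ s = R j ζ' s
  inv : ∀ j ζ, ζ ∈ C.hatX j (y j) (z j) → C.Lmap j (y j) (z j) (R j ζ) = ζ

variable {C} {y : ∀ i, Fin (C.KN i) → ℝ} {z : ∀ i, Fin (T+1) → Fin (S.n i) → ℝ}

theorem IsCausalSection.lsBel_eq
    {R : ∀ j : Fin M, (Fin (T+1) → Fin (S.n j) → ℝ) → (Fin (T+1) → Fin (S.n j) → ℝ)}
    (hR : C.IsCausalSection y z R) {i : Fin M} {ζ : S.Beliefs i}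
    (hζ : ∀ j, ζ j ∈ C.hatX j.1 (y j.1) (z j.1)) :
    C.lsBel y z i (fun j => R j.1 (ζ j)) = ζ :=
  funext fun j => hR.inv j.1 (ζ j) (hζ j)

theorem FeasLS.comp_section
    {R : ∀ j : Fin M, (Fin (T+1) → Fin (S.n j) → ℝ) → (Fin (T+1) → Fin (S.n j) → ℝ)}
    (hR : C.IsCausalSection y z R) {Γ : S.LPol} (hΓ : C.FeasLS Γ y z) :
    C.FeasLX (fun i k ξi ζ => Γ i k ξi (fun j => R j.1 (ζ j))) y z := by
  obtain ⟨hcaus, hy, hcns⟩ := hΓ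
  refine ⟨fun i k ξ ξ' ζ ζ' hζ hζ' hξ h => ?_, hy, fun i ξi hξ ζ hζ x hx => ?_⟩
  · exact hcaus i k ξ ξ' _ _ (fun j => hR.mem j.1 _ (hζ j)) (fun j => hR.mem j.1 _ (hζ' j)) hξ
      fun j => hR.causal j.1 _ _ (hζ j) (hζ' j) k.castSucc (h j)
  · exact hcns i ξi hξ _ (fun j => hR.mem j.1 _ (hζ j)) x ((hR.lsBel_eq hζ).symm ▸ hx)

theorem IsCausalSection.costLX_le
    {R : ∀ j : Fin M, (Fin (T+1) → Fin (S.n j) → ℝ) → (Fin (T+1) → Fin (S.n j) → ℝ)}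
    (hR : C.IsCausalSection y z R) (Γ : S.LPol) (i : Fin M) :
    C.CostLX (fun i k ξi ζ => Γ i k ξi (fun j => R j.1 (ζ j))) y z i ≤ C.CostLS Γ y z i := by
  refine sSup_le_sSup ?_
  rintro v ⟨ξi, hξ, ζ, hζ, x, hx, rfl⟩
  exact ⟨ξi, hξ, _, fun j => hR.mem j.1 _ (hζ j), x, (hR.lsBel_eq hζ).symm ▸ hx, rfl⟩

theorem Lmap_mem_hatX {i : Fin M} (hc0 : ∀ k, (0 : Fin (C.lk i k) → ℝ) ∈ C.Kc i k)
    {yi : Fin (C.KN i) → ℝ} (hy : ∀ k, 0 ≤ yi k) (zi : Fin (T+1) → Fin (S.n i) → ℝ)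
    {s : Fin (T+1) → Fin (S.n i) → ℝ} (hs : s ∈ C.prim i) :
    C.Lmap i yi zi s ∈ C.hatX i yi zi := by
  refine ⟨fun k => yi k • s, by simp [Lmap], fun k => ?_⟩
  rw [map_smul, map_smul, ← smul_sub]
  rcases (hy k).eq_or_lt with h | h
  · rw [← h, zero_smul]
    exact hc0 k
  · exact (C.Kc i k).smul_mem h (hs k)

theorem Lmap_apply_congr {i : Fin M}
    (hstage : ∀ k (v w : Fin (T+1) → Fin (S.n i) → ℝ) (t : Fin (T+1)),
      v t = w t → C.Pm i k v t = C.Pm i k w t)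
    (yi : Fin (C.KN i) → ℝ) (zi : Fin (T+1) → Fin (S.n i) → ℝ)
    {v w : Fin (T+1) → Fin (S.n i) → ℝ} {t : Fin (T+1)} (h : v t = w t) :
    C.Lmap i yi zi v t = C.Lmap i yi zi w t := by
  simp only [Lmap, Pi.add_apply, Finset.sum_apply, Pi.smul_apply, hstage _ v w t h]

theorem FeasLX.comp_lsBel (hc0 : ∀ i k, (0 : Fin (C.lk i k) → ℝ) ∈ C.Kc i k)
    (hstage : ∀ i k (v w : Fin (T+1) → Fin (S.n i) → ℝ) (t : Fin (T+1)),
      v t = w t → C.Pm i k v t = C.Pm i k w t)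
    {Ψ : S.LPol} (hΨ : C.FeasLX Ψ y z) :
    C.FeasLS (fun i k ξi s => Ψ i k ξi (C.lsBel y z i s)) y z := by
  obtain ⟨hcaus, hy, hcns⟩ := hΨ
  have hmem : ∀ {i} {s : S.Beliefs i}, (∀ j, s j ∈ C.prim j.1) →
      ∀ j, C.lsBel y z i s j ∈ C.hatX j.1 (y j.1) (z j.1) :=
    fun hs j => Lmap_mem_hatX (hc0 j.1) (hy j.1) (z j.1) (hs j)
  refine ⟨fun i k ξ ξ' s s' hs hs' hξ h => ?_, hy, fun i ξi hξ s hs x hx => ?_⟩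
  · exact hcaus i k ξ ξ' _ _ (hmem hs) (hmem hs') hξ
      fun j t ht => Lmap_apply_congr (hstage j.1) _ _ (h j t ht)
  · exact hcns i ξi hξ _ (hmem hs) x hx

theorem costLS_comp_lsBel_le (hc0 : ∀ i k, (0 : Fin (C.lk i k) → ℝ) ∈ C.Kc i k)
    (hy : ∀ i k, 0 ≤ y i k) (Ψ : S.LPol) (i : Fin M) :
    C.CostLS (fun i k ξi s => Ψ i k ξi (C.lsBel y z i s)) y z i ≤ C.CostLX Ψ y z i := by
  refine sSup_le_sSup ?_
  rintro v ⟨ξi, hξ, s, hs, x, hx, rfl⟩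
  exact ⟨ξi, hξ, _, fun j => Lmap_mem_hatX (hc0 j.1) (hy j.1) (z j.1) (hs j), x, hx, rfl⟩

theorem optLS_le_optLX (hc0 : ∀ i k, (0 : Fin (C.lk i k) → ℝ) ∈ C.Kc i k)
    (hstage : ∀ i k (v w : Fin (T+1) → Fin (S.n i) → ℝ) (t : Fin (T+1)),
      v t = w t → C.Pm i k v t = C.Pm i k w t) :
    C.OptLS ≤ C.OptLX := by
  refine le_sInf ?_
  rintro v ⟨Ψ, y, z, hΨ, rfl⟩
  exact sInf_le_of_le ⟨_, y, z, hΨ.comp_lsBel hc0 hstage, rfl⟩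
    (Finset.sum_le_sum fun i _ => costLS_comp_lsBel_le hc0 hΨ.2.1 Ψ i)

theorem optLX_le_optLS
    (hR : ∀ (y : ∀ i, Fin (C.KN i) → ℝ), (∀ i k, 0 ≤ y i k) →
      ∀ z : ∀ i, Fin (T+1) → Fin (S.n i) → ℝ, ∃ R, C.IsCausalSection y z R) :
    C.OptLX ≤ C.OptLS := by
  refine le_sInf ?_
  rintro v ⟨Γ, y, z, hΓ, rfl⟩
  obtain ⟨R, hR⟩ := hR y hΓ.2.1 z
  exact sInf_le_of_le ⟨_, y, z, hΓ.comp_section hR, rfl⟩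
    (Finset.sum_le_sum fun i _ => hR.costLX_le Γ i)

end ConicData

/-- converse direction of Theorem 4: suppose each forecast set `X̂ⱼ(yⱼ,zⱼ)`
admits a stage-wise causal map `Rⱼ` into the primitive set `Sⱼ` with `Lⱼ ∘ Rⱼ = id` on
`X̂ⱼ(yⱼ,zⱼ)` (and such maps exist for every admissible scaling and translation).  Then for
every feasible solution `(Γ, y, z)` of Problem LS the composed policies
`Ψ_{i,t}(ξᵢ^{t−1}, ζ_{Nᵢ}^t) = Γ_{i,t}(ξᵢ^{t−1}, ((Rⱼ(ζⱼ))_{j∈Nᵢ})^t)` form a feasible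
solution of Problem LX̂ whose per-agent worst-case cost is at most that of `(Γ, y, z)`;
hence the optimal value of Problem LX̂ is at most that of Problem LS and, combined with the
reverse construction via the maps `Lⱼ`, the two optimal values are equal. -/
theorem stmt6 {M T : ℕ} (S : NetSys M T) (C : ConicData S)
    (hne : ∀ i, (S.unc i).Nonempty)
    (hcvx : ∀ i, Convex ℝ (S.unc i))
    (hcpt : ∀ i, IsCompact (S.unc i))
    (hc0 : ∀ i k, (0 : Fin (C.lk i k) → ℝ) ∈ C.Kc i k)
    (hPP : ∀ i k, (C.Pm i k).comp (C.Pm i k) = C.Pm i k)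
    (hPO : ∀ i k k', k ≠ k' → (C.Pm i k).comp (C.Pm i k') = 0)
    (hPI : ∀ i, (∑ k, C.Pm i k) = LinearMap.id)
    (hstage : ∀ i k (v w : Fin (T+1) → Fin (S.n i) → ℝ) (t : Fin (T+1)),
      v t = w t → C.Pm i k v t = C.Pm i k w t)
    (hSne : ∀ i, (C.prim i).Nonempty)
    (hScpt : ∀ i, IsCompact (C.prim i))
    (y : ∀ i, Fin (C.KN i) → ℝ) (z : ∀ i, Fin (T+1) → Fin (S.n i) → ℝ)
    (R : ∀ j : Fin M, (Fin (T+1) → Fin (S.n j) → ℝ) → (Fin (T+1) → Fin (S.n j) → ℝ))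
    (hRmem : ∀ j ζ, ζ ∈ C.hatX j (y j) (z j) → R j ζ ∈ C.prim j)
    (hRcaus : ∀ j ζ ζ', ζ ∈ C.hatX j (y j) (z j) → ζ' ∈ C.hatX j (y j) (z j) →
      ∀ t : Fin (T+1), (∀ s : Fin (T+1), (s : ℕ) ≤ (t : ℕ) → ζ s = ζ' s) →
        ∀ s : Fin (T+1), (s : ℕ) ≤ (t : ℕ) → R j ζ s = R j ζ' s)
    (hRinv : ∀ j ζ, ζ ∈ C.hatX j (y j) (z j) → C.Lmap j (y j) (z j) (R j ζ) = ζ)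
    (hRall : ∀ (y' : ∀ i, Fin (C.KN i) → ℝ), (∀ i k, 0 ≤ y' i k) →
      ∀ (z' : ∀ i, Fin (T+1) → Fin (S.n i) → ℝ) (j : Fin M),
      ∃ R' : (Fin (T+1) → Fin (S.n j) → ℝ) → (Fin (T+1) → Fin (S.n j) → ℝ),
        (∀ ζ, ζ ∈ C.hatX j (y' j) (z' j) → R' ζ ∈ C.prim j) ∧
        (∀ ζ ζ', ζ ∈ C.hatX j (y' j) (z' j) → ζ' ∈ C.hatX j (y' j) (z' j) →
          ∀ t : Fin (T+1), (∀ s : Fin (T+1), (s : ℕ) ≤ (t : ℕ) → ζ s = ζ' s) →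
            ∀ s : Fin (T+1), (s : ℕ) ≤ (t : ℕ) → R' ζ s = R' ζ' s) ∧
        (∀ ζ, ζ ∈ C.hatX j (y' j) (z' j) → C.Lmap j (y' j) (z' j) (R' ζ) = ζ))
    (Γ : S.LPol) (hfeas : C.FeasLS Γ y z) :
    C.FeasLX (fun i k ξi ζ => Γ i k ξi (fun j => R j.1 (ζ j))) y z ∧
    (∀ i, C.CostLX (fun i k ξi ζ => Γ i k ξi (fun j => R j.1 (ζ j))) y z i ≤
      C.CostLS Γ y z i) ∧
    C.OptLX ≤ C.OptLS ∧ C.OptLX = C.OptLS := by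
  have hRsec : C.IsCausalSection y z R := ⟨hRmem, hRcaus, hRinv⟩
  have hle : C.OptLX ≤ C.OptLS := ConicData.optLX_le_optLS fun y' hy' z' => by
    choose R' hmem hcaus hinv using hRall y' hy' z'
    exact ⟨R', hmem, hcaus, hinv⟩
  exact ⟨hfeas.comp_section hRsec, hRsec.costLX_le Γ, hle,
    hle.antisymm (ConicData.optLS_le_optLX hc0 hstage)⟩
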